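/- arXiv:2402.13971 — 2 statements merged into one kernel-verified Lean document; each statement's English description precedes it below -/
import Mathlib

section
/- Substitution law for multi-indice B-series (at step size h = 1; general h is recovered by rescaling the coefficient maps). Let g : ℝ → ℝ be C^∞, let a be a finitely supported real-valued map on populated multi-indices together with a value a(𝟎) ∈ ℝ, and let b be a finitely supported real-valued map on populated multi-indices. Define G : ℝ → ℝ by G(y) := g(y) + ∑_{β populated} (b(β)/S(β)) · F_g[z^β](y) (a finite sum; G is C^∞). For a populated multi-indice γ define (b⋆₁a)(γ) := ∑_{n ≥ 0} (1/n!) ∑_α ∑_{(β_1,…,β_n)} a(α) · (∏_{j=1}^n b(β_j)) · S(γ)/(S(α) · ∏_{j=1}^n S(β_j)) · c_γ((β_1, …, β_n) ⋆₁ z^α), where α runs over populated multi-indices, (β_1, …, β_n) over ordered n-tuples of populated multi-indices, and c_γ(p) denotes the coefficient of the monomial z^γ in the polynomial p; only finitely many summands are nonzero, and b⋆₁a is finitely supported. Then for every y ∈ ℝ: a(𝟎)·y + ∑_{α populated} (a(α)/S(α)) · ∏_k (G^{(k)}(y))^{α(k)} = a(𝟎)·y + ∑_{γ populated} ((b⋆₁a)(γ)/S(γ))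 · F_g[z^γ](y), both sums being finite. That is, substituting the B-series vector field G for g in the B-series with coefficients a yields the B-series with coefficients b⋆₁a. -/
open MvPolynomial
open scoped Classical

/-- Multi-indices: finitely supported functions `ℕ → ℕ`. -/
abbrev MI := ℕ →₀ ℕ

/-- The monomial `z^β = ∏_k X_k^{β k}` in `ℝ[X_0, X_1, …]`. -/
noncomputable def zm (β : MI) : MvPolynomial ℕ ℝ := monomial β 1

/-- `β` is populated if `∑_k (1 - k) β(k) = 1`. -/
def Populated (β : MI) : Prop := (β.sum fun k n => (1 - (k : ℤ)) * n) = 1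

/-- The symmetry factor `S(β) = ∏_k (k!)^{β k}`. -/
noncomputable def S (β : MI) : ℝ := β.prod fun k n => (k.factorial : ℝ) ^ n

/-- The derivation `D` with `D X_k = X_{k+1}`. -/
noncomputable def Dop (p : MvPolynomial ℕ ℝ) : MvPolynomial ℕ ℝ :=
  ∑ᶠ k : ℕ, X (k + 1) * pderiv k p

/-- The elementary differential `F_g[p](y)`: evaluate `p` at `X_k ↦ g^{(k)}(y)`. -/
noncomputable def Ff (g : ℝ → ℝ) (p : MvPolynomial ℕ ℝ) (y : ℝ) : ℝ :=
  eval (fun k => iteratedDeriv k g y) p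

/-- Iterated partial derivatives `∂_{X_{k_1}} ⋯ ∂_{X_{k_n}}`. -/
noncomputable def pderivs : {n : ℕ} → (Fin n → ℕ) → MvPolynomial ℕ ℝ → MvPolynomial ℕ ℝ
  | 0, _, p => p
  | _ + 1, k, p => pderivs (k ∘ Fin.succ) (pderiv (k 0) p)

/-- The simultaneous insertion `(β_1, …, β_n) ⋆₁ p`. -/
noncomputable def insert1 {n : ℕ} (βs : Fin n → MI) (p : MvPolynomial ℕ ℝ) :
    MvPolynomial ℕ ℝ :=
  ∑ᶠ k : Fin n → ℕ, (∏ j, Dop^[k j] (zm (βs j))) * pderivs k p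

/-- The substitution product `(b ⋆₁ a)(γ)`. -/
noncomputable def star1 (b a : MI → ℝ) (γ : MI) : ℝ :=
  ∑ᶠ n : ℕ, (n.factorial : ℝ)⁻¹ *
    ∑ᶠ α : MI, ∑ᶠ βs : Fin n → MI,
      if Populated α ∧ ∀ j, Populated (βs j) then
        a α * (∏ j, b (βs j)) * (S γ / (S α * ∏ j, S (βs j))) *
          coeff γ (insert1 βs (zm α))
      else 0

namespace MultiindexBSeries

lemma Ff_add (g : ℝ → ℝ) (p q : MvPolynomial ℕ ℝ) (y : ℝ) :
    Ff g (p + q) y = Ff g p y + Ff g q y := map_add _ _ _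

lemma vars_pderiv_subset (i : ℕ) (p : MvPolynomial ℕ ℝ) : (pderiv i p).vars ⊆ p.vars := by
  intro j hj
  obtain ⟨m, hm, hjm⟩ := (mem_vars_iff_mem_support j).1 hj
  rw [mem_support_iff, coeff_pderiv] at hm
  refine (mem_vars_iff_mem_support j).2 ⟨m + Finsupp.single i 1,
    mem_support_iff.2 (left_ne_zero_of_mul hm), ?_⟩
  rw [Finsupp.mem_support_iff] at hjm ⊢
  rw [Finsupp.add_apply]
  omega

lemma pderivs_zero : ∀ {n : ℕ} (k : Fin n → ℕ), pderivs k 0 = 0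
  | 0, _ => rfl
  | _ + 1, k => by rw [pderivs, map_zero, pderivs_zero]

lemma pderivs_eq_zero_of_notMem_vars {s : Finset ℕ} :
    ∀ {n : ℕ} (k : Fin n → ℕ) (p : MvPolynomial ℕ ℝ), p.vars ⊆ s → ∀ j, k j ∉ s → pderivs k p = 0
  | 0, _, _, _, j, _ => j.elim0
  | n + 1, k, p, hp, j, hj => by
    rw [pderivs]
    induction j using Fin.cases with
    | zero => rw [pderiv_eq_zero_of_notMem_vars fun h => hj (hp h), pderivs_zero]
    | succ j => exact pderivs_eq_zero_of_notMem_vars _ _ ((vars_pderiv_subset _ _).trans hp) j hj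

lemma pderivs_eq_zero_of_degree_lt :
    ∀ {n : ℕ} (k : Fin n → ℕ) (p : MvPolynomial ℕ ℝ), (∀ m ∈ p.support, m.degree < n) →
      pderivs k p = 0
  | 0, _, p, hp => by
    rw [pderivs, ← support_eq_empty]
    exact Finset.eq_empty_of_forall_notMem fun m hm => Nat.not_lt_zero _ (hp m hm)
  | n + 1, k, p, hp => by
    rw [pderivs]
    refine pderivs_eq_zero_of_degree_lt _ _ fun m hm => ?_
    rw [mem_support_iff, coeff_pderiv] at hm
    have := hp _ (mem_support_iff.2 (left_ne_zero_of_mul hm))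
    rw [map_add, Finsupp.degree_single] at this
    omega

lemma insert1_eq_sum {n : ℕ} (βs : Fin n → MI) {p : MvPolynomial ℕ ℝ} {s : Finset ℕ}
    (hp : p.vars ⊆ s) :
    insert1 βs p = ∑ k ∈ Fintype.piFinset fun _ : Fin n => s,
      (∏ j, Dop^[k j] (zm (βs j))) * pderivs k p := by
  refine finsum_eq_sum_of_support_subset _ fun k hk => ?_
  rw [Finset.mem_coe, Fintype.mem_piFinset]
  by_contra! h
  obtain ⟨j, hj⟩ := h
  exact hk (by simp only [pderivs_eq_zero_of_notMem_vars k p hp j hj, mul_zero])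

lemma insert1_eq_zero_of_degree_lt {n : ℕ} (βs : Fin n → MI) {α : MI} (h : α.degree < n) :
    insert1 βs (zm α) = 0 := by
  rw [insert1_eq_sum βs subset_rfl]
  refine Finset.sum_eq_zero fun k _ => ?_
  rw [pderivs_eq_zero_of_degree_lt, mul_zero]
  intro m hm
  rwa [Finset.mem_singleton.1 (support_monomial_subset hm)]

/-! ### The derivation `D` -/

lemma derivation_sum_apply (s : Finset ℕ)
    (d : ℕ → Derivation ℝ (MvPolynomial ℕ ℝ) (MvPolynomial ℕ ℝ)) (p : MvPolynomial ℕ ℝ) :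
    (∑ k ∈ s, d k) p = ∑ k ∈ s, d k p := by
  induction s using Finset.induction_on with
  | empty => simp
  | insert k s hk ih => rw [Finset.sum_insert hk, Finset.sum_insert hk, Derivation.add_apply, ih]

lemma Dop_eq_mkDerivation (p : MvPolynomial ℕ ℝ) :
    Dop p = mkDerivation ℝ (fun k => X (k + 1)) p := by
  have hs : Dop p = ∑ k ∈ p.vars, X (k + 1) * pderiv k p := by
    refine finsum_eq_sum_of_support_subset _ fun k hk => ?_
    by_contra h
    exact hk (by simp only [pderiv_eq_zero_of_notMem_vars h, mul_zero])
  have hd : ∑ k ∈ p.vars, X (k + 1) * pderiv k p =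
      (∑ k ∈ p.vars, (X (k + 1) : MvPolynomial ℕ ℝ) • pderiv (R := ℝ) k) p := by
    simp [derivation_sum_apply]
  rw [hs, hd]
  refine derivation_eq_of_forall_mem_vars fun i hi => ?_
  simp [derivation_sum_apply, mkDerivation_X, Pi.single_apply, hi]

lemma Dop_add (p q : MvPolynomial ℕ ℝ) : Dop (p + q) = Dop p + Dop q := by
  simp only [Dop_eq_mkDerivation, map_add]

lemma Dop_X (k : ℕ) : Dop (X k) = X (k + 1) := by
  rw [Dop_eq_mkDerivation, mkDerivation_X]

lemma Dop_iterate_X (k : ℕ) : Dop^[k] (X 0) = X k := by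
  induction k with
  | zero => rfl
  | succ k ih => rw [Function.iterate_succ_apply', ih, Dop_X]

lemma Dop_iterate_eq_pow (k : ℕ) (p : MvPolynomial ℕ ℝ) :
    Dop^[k] p = ((mkDerivation ℝ (fun k => (X (k + 1) : MvPolynomial ℕ ℝ))).toLinearMap ^ k) p := by
  rw [Module.End.pow_apply]
  exact congrArg (fun f => f^[k] p) (funext Dop_eq_mkDerivation)

lemma hasDerivAt_Ff {g : ℝ → ℝ} (hg : ContDiff ℝ (⊤ : ℕ∞) g) (p : MvPolynomial ℕ ℝ) (y : ℝ) :
    HasDerivAt (Ff g p) (Ff g (Dop p) y) y := by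
  simp only [Dop_eq_mkDerivation]
  induction p using MvPolynomial.induction_on with
  | C r =>
    have : Ff g (C r) = fun _ => r := by ext; simp [Ff]
    rw [this]
    simpa [Ff] using hasDerivAt_const y r
  | add p q hp hq =>
    have : Ff g (p + q) = fun y => Ff g p y + Ff g q y := by ext; simp [Ff]
    rw [this, map_add, Ff_add]
    exact hp.add hq
  | mul_X p i hp =>
    have : Ff g (p * X i) = fun y => Ff g p y * iteratedDeriv i g y := by ext; simp [Ff]
    rw [this]
    have hi : HasDerivAt (iteratedDeriv i g) (iteratedDeriv (i + 1) g y) y := by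
      rw [iteratedDeriv_succ]
      exact ((hg.differentiable_iteratedDeriv i
        (by exact_mod_cast WithTop.coe_lt_top (i : ℕ))) y).hasDerivAt
    convert! hp.mul hi using 1
    simp only [Ff, Derivation.leibniz, mkDerivation_X, smul_eq_mul, map_add, map_mul, eval_X]
    ring

lemma iteratedDeriv_Ff {g : ℝ → ℝ} (hg : ContDiff ℝ (⊤ : ℕ∞) g) (p : MvPolynomial ℕ ℝ) (k : ℕ) :
    iteratedDeriv k (Ff g p) = Ff g (Dop^[k] p) := by
  induction k with
  | zero => exact iteratedDeriv_zero
  | succ k ih =>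
    rw [iteratedDeriv_succ, ih, Function.iterate_succ_apply']
    exact funext fun y => (hasDerivAt_Ff hg _ y).deriv

/-! ### Taylor expansion of polynomials -/

/-- The directional derivative `∑_{k ∈ s} v_k ∂_{X_k}` with constant coefficients. -/
noncomputable def dirDeriv (s : Finset ℕ) (v : ℕ → ℝ) :
    Derivation ℝ (MvPolynomial ℕ ℝ) (MvPolynomial ℕ ℝ) :=
  ∑ k ∈ s, v k • pderiv k

lemma dirDeriv_apply (s : Finset ℕ) (v : ℕ → ℝ) (p : MvPolynomial ℕ ℝ) :
    dirDeriv s v p = ∑ k ∈ s, v k • pderiv k p := by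
  simp [dirDeriv, derivation_sum_apply]

lemma dirDeriv_X (s : Finset ℕ) (v : ℕ → ℝ) (i : ℕ) :
    dirDeriv s v (X i) = C (if i ∈ s then v i else 0) := by
  simp [dirDeriv_apply, Pi.single_apply, smul_eq_C_mul]
  split_ifs <;> simp

lemma sum_piFinset_succ {ι M : Type*} [AddCommMonoid M] (s : Finset ι) (n : ℕ)
    (f : (Fin (n + 1) → ι) → M) :
    ∑ k ∈ Fintype.piFinset (fun _ => s), f k =
      ∑ i ∈ s, ∑ k ∈ Fintype.piFinset (fun _ : Fin n => s), f (Fin.cons i k) := by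
  rw [← Finset.sum_product']
  refine Finset.sum_bij' (fun k _ => (k 0, Fin.tail k)) (fun q _ => Fin.cons q.1 q.2) ?_ ?_ ?_ ?_ ?_
  · intro k hk
    rw [Fintype.mem_piFinset] at hk
    exact Finset.mem_product.2 ⟨hk 0, Fintype.mem_piFinset.2 fun j => hk j.succ⟩
  · intro q hq
    rw [Finset.mem_product, Fintype.mem_piFinset] at hq
    rw [Fintype.mem_piFinset]
    exact Fin.cases hq.1 hq.2
  · intro k _
    exact Fin.cons_self_tail k
  · intro q _
    rfl
  · intro k _
    simp only [Fin.cons_self_tail]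

lemma sum_prod_smul_pderivs (s : Finset ℕ) (v : ℕ → ℝ) (n : ℕ) (p : MvPolynomial ℕ ℝ) :
    ∑ k ∈ Fintype.piFinset (fun _ : Fin n => s), (∏ j, v (k j)) • pderivs k p =
      (dirDeriv s v)^[n] p := by
  induction n generalizing p with
  | zero => simp [pderivs]
  | succ n ih =>
    rw [sum_piFinset_succ, Function.iterate_succ_apply, dirDeriv_apply]
    have hlin : ∀ q, (dirDeriv s v)^[n] q = ((dirDeriv s v).toLinearMap ^ n) q := fun q => by
      rw [Module.End.pow_apply]; rfl
    rw [hlin, map_sum]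
    refine Finset.sum_congr rfl fun i _ => ?_
    rw [map_smul, ← hlin, ← ih, Finset.smul_sum]
    refine Finset.sum_congr rfl fun k _ => ?_
    rw [smul_smul, Fin.prod_univ_succ]
    rfl

lemma dirDeriv_iterate_mul_X (s : Finset ℕ) (v : ℕ → ℝ) (i n : ℕ) (p : MvPolynomial ℕ ℝ) :
    (dirDeriv s v)^[n + 1] (p * X i) = (dirDeriv s v)^[n + 1] p * X i +
      ((n + 1) * if i ∈ s then v i else 0 : ℝ) • (dirDeriv s v)^[n] p := by
  induction n with
  | zero =>
    simp only [Function.iterate_succ_apply, Function.iterate_zero_apply, Derivation.leibniz,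
      dirDeriv_X, smul_eq_mul, smul_eq_C_mul]
    simp only [Nat.cast_zero, zero_add, one_mul]
    ring
  | succ n ih =>
    rw [Function.iterate_succ_apply', ih, map_add, Derivation.leibniz, dirDeriv_X,
      Derivation.map_smul, ← Function.iterate_succ_apply' (dirDeriv s v) n p,
      ← Function.iterate_succ_apply' (dirDeriv s v) (n + 1) p]
    simp only [smul_eq_mul, smul_eq_C_mul, Nat.cast_add, Nat.cast_one, map_mul, map_add, map_one]
    ring

lemma hasSum_taylor (s : Finset ℕ) (x v : ℕ → ℝ) (p : MvPolynomial ℕ ℝ) :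
    HasSum (fun n : ℕ => (n.factorial : ℝ)⁻¹ * eval x ((dirDeriv s v)^[n] p))
      (eval (fun k => x k + if k ∈ s then v k else 0) p) := by
  induction p using MvPolynomial.induction_on with
  | C r =>
    convert hasSum_single (f := fun n : ℕ =>
      (n.factorial : ℝ)⁻¹ * eval x ((dirDeriv s v)^[n] (C r))) 0 ?_ using 1
    · simp
    · intro n hn
      obtain ⟨n, rfl⟩ := Nat.exists_eq_succ_of_ne_zero hn
      rw [Function.iterate_succ_apply, derivation_C, iterate_map_zero, map_zero, mul_zero]
  | add p q hp hq =>
    convert! hp.add hq using 1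
    · ext n
      rw [iterate_map_add, map_add, mul_add]
    · exact map_add _ _ _
  | mul_X p i hp =>
    have h₁ := ((hasSum_nat_add_iff' 1).2 hp).mul_right (x i)
    have h₂ := hp.mul_left (if i ∈ s then v i else 0)
    rw [← hasSum_nat_add_iff' 1]
    convert! h₁.add h₂ using 1
    · funext n
      rw [dirDeriv_iterate_mul_X, map_add, map_mul, eval_X, smul_eval, Nat.factorial_succ]
      have : (n.factorial : ℝ) ≠ 0 := by positivity
      push_cast
      field_simp
    · simp only [Finset.sum_range_one, Function.iterate_zero_apply, map_mul, eval_X]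
      simp only [Nat.factorial_zero, Nat.cast_one, inv_one, one_mul]
      ring

/-! ### Weights -/

/-- The weight `1 - k` of the variable `X_k`. -/
def wt (k : ℕ) : ℤ := 1 - k

lemma populated_iff (β : MI) : Populated β ↔ Finsupp.weight wt β = 1 := by
  rw [Populated, Finsupp.weight_apply]
  simp only [wt, nsmul_eq_mul, mul_comm]

lemma isWeightedHomogeneous_zm {β : MI} (h : Populated β) :
    IsWeightedHomogeneous wt (zm β) 1 :=
  isWeightedHomogeneous_monomial _ _ _ ((populated_iff β).1 h)

lemma isWeightedHomogeneous_Dop {p : MvPolynomial ℕ ℝ} {m : ℤ}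
    (hp : IsWeightedHomogeneous wt p m) : IsWeightedHomogeneous wt (Dop p) (m - 1) := by
  refine finsum_induction (IsWeightedHomogeneous wt · (m - 1)) (isWeightedHomogeneous_zero ℝ wt _)
    (fun _ _ h h' => h.add h') fun k => ?_
  have := (isWeightedHomogeneous_X ℝ wt (k + 1)).mul
    (hp.pderiv (i := k) (n' := m - wt k) (sub_add_cancel _ _))
  convert this using 1
  simp only [wt]
  push_cast
  ring

lemma isWeightedHomogeneous_Dop_iterate {p : MvPolynomial ℕ ℝ} {m : ℤ}
    (hp : IsWeightedHomogeneous wt p m) (k : ℕ) :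
    IsWeightedHomogeneous wt (Dop^[k] p) (m - k) := by
  induction k with
  | zero => simpa using hp
  | succ k ih =>
    rw [Function.iterate_succ_apply']
    convert isWeightedHomogeneous_Dop ih using 1
    push_cast
    ring

lemma isWeightedHomogeneous_pderivs :
    ∀ {n : ℕ} (k : Fin n → ℕ) {p : MvPolynomial ℕ ℝ} {m : ℤ}, IsWeightedHomogeneous wt p m →
      IsWeightedHomogeneous wt (pderivs k p) (m - ∑ j, wt (k j))
  | 0, _, _, _, hp => by simpa [pderivs] using hp
  | n + 1, k, p, m, hp => by
    have := isWeightedHomogeneous_pderivs (k ∘ Fin.succ)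
      (hp.pderiv (i := k 0) (n' := m - wt (k 0)) (sub_add_cancel _ _))
    rw [sub_sub] at this
    rwa [Fin.sum_univ_succ]

lemma isWeightedHomogeneous_insert1 {n : ℕ} {βs : Fin n → MI} {p : MvPolynomial ℕ ℝ}
    (hβ : ∀ j, Populated (βs j)) (hp : IsWeightedHomogeneous wt p 1) :
    IsWeightedHomogeneous wt (insert1 βs p) 1 := by
  refine finsum_induction (IsWeightedHomogeneous wt · 1) (isWeightedHomogeneous_zero ℝ wt _)
    (fun _ _ h h' => h.add h') fun k => ?_
  have := (IsWeightedHomogeneous.prod Finset.univ _ (fun j => wt (k j)) fun j _ =>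
    isWeightedHomogeneous_Dop_iterate (isWeightedHomogeneous_zm (hβ j)) (k j)).mul
    (isWeightedHomogeneous_pderivs k hp)
  rwa [add_sub_cancel] at this

/-! ### The substitution product -/

lemma S_ne_zero (β : MI) : S β ≠ 0 :=
  Finset.prod_ne_zero_iff.2 fun _ _ => pow_ne_zero _ (Nat.cast_ne_zero.2 (Nat.factorial_ne_zero _))

/-- The sum over `n`-tuples from `B` of the weighted simultaneous insertions into `p`. -/
noncomputable def insertSum (b : MI → ℝ) (B : Finset MI) (n : ℕ) (p : MvPolynomial ℕ ℝ) :
    MvPolynomial ℕ ℝ :=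
  ∑ βs ∈ Fintype.piFinset (fun _ : Fin n => B), (∏ j, b (βs j) / S (βs j)) • insert1 βs p

lemma eval_insertSum (b : MI → ℝ) (B : Finset MI) (n : ℕ) {p : MvPolynomial ℕ ℝ} {s : Finset ℕ}
    (hp : p.vars ⊆ s) (x : ℕ → ℝ) :
    eval x (insertSum b B n p) = eval x ((dirDeriv s fun k =>
      eval x (Dop^[k] (∑ β ∈ B, (b β / S β) • zm β)))^[n] p) := by
  have hD : ∀ k, eval x (Dop^[k] (∑ β ∈ B, (b β / S β) • zm β)) =
      ∑ β ∈ B, b β / S β * eval x (Dop^[k] (zm β)) := fun k => by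
    simp only [Dop_iterate_eq_pow, map_sum, map_smul, smul_eval]
  rw [← sum_prod_smul_pderivs, insertSum, map_sum, map_sum]
  simp only [smul_eval, hD, insert1_eq_sum _ hp, map_sum, Finset.mul_sum, map_mul, map_prod]
  rw [Finset.sum_comm]
  refine Finset.sum_congr rfl fun k _ => ?_
  rw [Finset.prod_univ_sum, Finset.sum_mul]
  refine Finset.sum_congr rfl fun βs _ => ?_
  rw [← mul_assoc, ← Finset.prod_mul_distrib]

/-- The polynomial whose coefficients are those of `b ⋆₁ a`, normalised by symmetry factors,
with insertions of at most `N - 1` multi-indices. -/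
noncomputable def starPoly (b a : MI → ℝ) (B A : Finset MI) (N : ℕ) : MvPolynomial ℕ ℝ :=
  ∑ n ∈ Finset.range N, (n.factorial : ℝ)⁻¹ •
    ∑ α ∈ A, (a α / S α) • insertSum b B n (zm α)

variable {a b : MI → ℝ} {A B : Finset MI}

lemma star1_eq_coeff_starPoly (hA : Function.support a ⊆ A) (hB : Function.support b ⊆ B)
    (hap : ∀ β, ¬ Populated β → a β = 0) (hbp : ∀ β, ¬ Populated β → b β = 0)
    {N : ℕ} (hN : ∀ α ∈ A, α.degree < N) (γ : MI) :
    star1 b a γ = S γ * coeff γ (starPoly b a B A N) := by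
  have hterm : ∀ (n : ℕ) (α : MI) (βs : Fin n → MI),
      (if Populated α ∧ ∀ j, Populated (βs j) then
        a α * (∏ j, b (βs j)) * (S γ / (S α * ∏ j, S (βs j))) * coeff γ (insert1 βs (zm α))
      else 0) = S γ * (a α / S α * ((∏ j, b (βs j) / S (βs j)) * coeff γ (insert1 βs (zm α)))) := by
    intro n α βs
    split_ifs with h
    · rw [Finset.prod_div_distrib]
      have := S_ne_zero α
      have : ∏ j, S (βs j) ≠ 0 := Finset.prod_ne_zero_iff.2 fun j _ => S_ne_zero (βs j)
      field_simp
    · rw [not_and_or] at h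
      rcases h with h | h
      · rw [hap α h]; simp
      · push Not at h
        obtain ⟨j, hj⟩ := h
        rw [Finset.prod_eq_zero (Finset.mem_univ j) (by rw [hbp _ hj, zero_div])]
        simp
  have hβ : ∀ (n : ℕ) (α : MI), (∑ᶠ βs : Fin n → MI, S γ * (a α / S α *
      ((∏ j, b (βs j) / S (βs j)) * coeff γ (insert1 βs (zm α))))) =
      S γ * (a α / S α * coeff γ (insertSum b B n (zm α))) := by
    intro n α
    rw [finsum_eq_sum_of_support_subset (s := Fintype.piFinset fun _ : Fin n => B)]
    · simp only [insertSum, coeff_sum, coeff_smul, smul_eq_mul, Finset.mul_sum]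
    · intro βs h
      rw [Finset.mem_coe, Fintype.mem_piFinset]
      intro j
      refine hB fun hj => h ?_
      simp only
      rw [Finset.prod_eq_zero (Finset.mem_univ j) (by rw [hj, zero_div])]
      simp
  have hα : ∀ n : ℕ, (∑ᶠ α : MI, S γ * (a α / S α * coeff γ (insertSum b B n (zm α)))) =
      S γ * coeff γ (∑ α ∈ A, (a α / S α) • insertSum b B n (zm α)) := by
    intro n
    rw [finsum_eq_sum_of_support_subset (s := A)]
    · simp only [coeff_sum, coeff_smul, smul_eq_mul, Finset.mul_sum]
    · intro α h
      refine hA fun hα => h ?_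
      simp only [hα, zero_div, zero_mul, mul_zero]
  simp only [star1, hterm, hβ, hα]
  rw [finsum_eq_sum_of_support_subset (s := Finset.range N)]
  · simp only [starPoly, coeff_sum (s := Finset.range N), coeff_smul, smul_eq_mul, Finset.mul_sum]
    refine Finset.sum_congr rfl fun n _ => by ring
  · intro n h
    rw [Finset.mem_coe, Finset.mem_range]
    by_contra! hn
    refine h ?_
    simp only
    rw [Finset.sum_eq_zero, coeff_zero, mul_zero, mul_zero]
    intro α hα
    rw [insertSum, Finset.sum_eq_zero, smul_zero]
    intro βs _
    rw [insert1_eq_zero_of_degree_lt βs ((hN α hα).trans_le hn), smul_zero]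

lemma isWeightedHomogeneous_starPoly (hA : ∀ α ∈ A, Populated α) (hB : ∀ β ∈ B, Populated β)
    (N : ℕ) : IsWeightedHomogeneous wt (starPoly b a B A N) 1 := by
  simp only [starPoly, insertSum, smul_eq_C_mul]
  refine IsWeightedHomogeneous.sum _ _ _ fun n _ => .C_mul (.sum _ _ _ fun α hα => .C_mul
    (.sum _ _ _ fun βs hβs => .C_mul (isWeightedHomogeneous_insert1 (fun j => ?_)
      (isWeightedHomogeneous_zm (hA α hα))) _) _) _
  exact hB _ (Fintype.mem_piFinset.1 hβs j)

lemma eval_starPoly {N : ℕ} (hN : ∀ α ∈ A, α.degree < N) (x : ℕ → ℝ) :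
    eval x (starPoly b a B A N) = ∑ α ∈ A, a α / S α * eval (fun k =>
      x k + eval x (Dop^[k] (∑ β ∈ B, (b β / S β) • zm β))) (zm α) := by
  simp only [starPoly, map_sum, smul_eval, Finset.mul_sum]
  rw [Finset.sum_comm]
  refine Finset.sum_congr rfl fun α hα => ?_
  set v : ℕ → ℝ := fun k => eval x (Dop^[k] (∑ β ∈ B, (b β / S β) • zm β)) with hv
  have htaylor := hasSum_taylor (zm α).vars x v (zm α)
  simp only [hv, ← eval_insertSum b B _ subset_rfl x] at htaylor
  have hfin := hasSum_sum_of_ne_finset_zero (s := Finset.range N)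
    (f := fun n : ℕ => (n.factorial : ℝ)⁻¹ * eval x (insertSum b B n (zm α)))
    (L := .unconditional ℕ) <| by
    intro n hn
    rw [Finset.mem_range, not_lt] at hn
    rw [insertSum, Finset.sum_eq_zero, map_zero, mul_zero]
    intro βs _
    rw [insert1_eq_zero_of_degree_lt βs ((hN α hα).trans_le hn), smul_zero]
  have heq := hfin.unique htaylor
  have hvars : eval (fun k => x k + if k ∈ (zm α).vars then v k else 0) (zm α) =
      eval (fun k => x k + v k) (zm α) :=
    eval₂Hom_congr' rfl (fun i hi _ => by rw [if_pos hi]) rfl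
  rw [← hvars, ← heq, Finset.mul_sum]
  exact Finset.sum_congr rfl fun n _ => by ring

end MultiindexBSeries

open MultiindexBSeries

/-- Substitution law for multi-indice B-series (at step size `h = 1`). -/
theorem substitution_law_multiindice_Bseries
    (g : ℝ → ℝ) (hg : ContDiff ℝ (⊤ : ℕ∞) g)
    (a0 : ℝ) (a b : MI → ℝ)
    (haf : (Function.support a).Finite) (hbf : (Function.support b).Finite)
    (hap : ∀ β, ¬ Populated β → a β = 0) (hbp : ∀ β, ¬ Populated β → b β = 0)
    (G : ℝ → ℝ)
    (hG : ∀ y, G y = g y + ∑ᶠ β : MI, if Populated β then b β / S β * Ff g (zm β) y else 0)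
    (y : ℝ) :
    a0 * y + (∑ᶠ α : MI, if Populated α then
        a α / S α * (α.prod fun k m => (iteratedDeriv k G y) ^ m) else 0)
    = a0 * y + ∑ᶠ γ : MI, if Populated γ then star1 b a γ / S γ * Ff g (zm γ) y else 0 := by
  congr 1
  set A := haf.toFinset with hAdef
  set B := hbf.toFinset with hBdef
  have hAs : Function.support a ⊆ A := by simp [hAdef]
  have hBs : Function.support b ⊆ B := by simp [hBdef]
  have hApop : ∀ α ∈ A, Populated α := fun α hα => by
    by_contra h
    exact (haf.mem_toFinset.1 hα) (hap α h)
  have hBpop : ∀ β ∈ B, Populated β := fun β hβ => by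
    by_contra h
    exact (hbf.mem_toFinset.1 hβ) (hbp β h)
  obtain ⟨N, hN⟩ : ∃ N, ∀ α ∈ A, Finsupp.degree α < N :=
    ⟨A.sup Finsupp.degree + 1, fun α hα => Nat.lt_succ_of_le (Finset.le_sup hα)⟩
  set P : MvPolynomial ℕ ℝ := ∑ β ∈ B, (b β / S β) • zm β with hP
  have hGF : G = Ff g (X 0 + P) := by
    ext z
    rw [hG, Ff_add]
    congr 1
    · simp [Ff]
    · rw [finsum_eq_sum_of_support_subset (s := B)]
      · simp only [hP, Ff, map_sum, smul_eval]
        exact Finset.sum_congr rfl fun β hβ => if_pos (hBpop β hβ)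
      · intro β h
        refine hBs fun hβ => h ?_
        simp [hβ]
  set x : ℕ → ℝ := fun k => iteratedDeriv k g y with hx
  have hGk : ∀ k, iteratedDeriv k G y = x k + eval x (Dop^[k] P) := by
    intro k
    rw [hGF, iteratedDeriv_Ff hg, Dop_iterate_eq_pow, map_add, ← Dop_iterate_eq_pow,
      ← Dop_iterate_eq_pow, Dop_iterate_X, Ff_add]
    simp [Ff, hx]
  have hleft : (∑ᶠ α : MI, if Populated α then
      a α / S α * (α.prod fun k m => (iteratedDeriv k G y) ^ m) else 0) =
      eval x (starPoly b a B A N) := by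
    rw [eval_starPoly hN, finsum_eq_sum_of_support_subset (s := A)]
    · refine Finset.sum_congr rfl fun α hα => ?_
      rw [if_pos (hApop α hα), zm, eval_monomial, one_mul]
      simp only [hGk, hP]
    · intro α h
      refine hAs fun hα => h ?_
      simp [hα]
  have hright : (∑ᶠ γ : MI, if Populated γ then star1 b a γ / S γ * Ff g (zm γ) y else 0) =
      eval x (starPoly b a B A N) := by
    rw [finsum_eq_sum_of_support_subset (s := (starPoly b a B A N).support), eval_eq]
    · refine Finset.sum_congr rfl fun γ hγ => ?_
      rw [if_pos ((populated_iff γ).2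
        (isWeightedHomogeneous_starPoly hApop hBpop N (mem_support_iff.1 hγ))),
        star1_eq_coeff_starPoly hAs hBs hap hbp hN, mul_div_cancel_left₀ _ (S_ne_zero γ),
        Ff, zm, eval_monomial, one_mul]
      rfl
    · intro γ h
      rw [Finset.mem_coe, mem_support_iff]
      intro hγ
      refine h ?_
      simp [star1_eq_coeff_starPoly hAs hBs hap hbp hN, hγ]
  rw [hleft, hright]
end

section
/- Key identity for the substitution law: let g : ℝ → ℝ be C^∞ and let b be a finitely supported real-valued map on populated multi-indices. Define G : ℝ → ℝ by G(y) := g(y) + ∑_{α populated} (b(α)/S(α)) · F_g[z^α](y) (a finite sum; G is C^∞). Then for every populated multi-indice β and every y ∈ ℝ: F_g[M_b(z^β)](y) = ∏_k (G^{(k)}(y))^{β(k)}, where G^{(k)} denotes the k-th derivative of G. -/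
open MvPolynomial
open scoped Classical

/-- The substitution operator
`M_b(p) = ∑_{n ≥ 0} (1/n!) ∑_{(α_1,…,α_n) populated} (∏_j b(α_j)/S(α_j)) (α_1,…,α_n) ⋆₁ p`. -/
noncomputable def Mop (b : MI → ℝ) (p : MvPolynomial ℕ ℝ) : MvPolynomial ℕ ℝ :=
  ∑ᶠ n : ℕ, (n.factorial : ℝ)⁻¹ •
    ∑ᶠ αs : Fin n → MI,
      if ∀ j, Populated (αs j) then (∏ j, b (αs j) / S (αs j)) • insert1 αs p else 0

/-- `D` as a bundled derivation. -/
noncomputable def Dder : Derivation ℝ (MvPolynomial ℕ ℝ) (MvPolynomial ℕ ℝ) :=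
  mkDerivation ℝ fun k => X (k + 1)

theorem Dop_eq_Dder (p : MvPolynomial ℕ ℝ) : Dop p = Dder p := by
  have h : Dop p = ∑ k ∈ p.vars, X (k + 1) * pderiv k p := by
    refine finsum_eq_sum_of_support_subset _ fun k hk => ?_
    by_contra hkp
    exact hk (by simp [pderiv_eq_zero_of_notMem_vars (by simpa using hkp)])
  have hsum (q : MvPolynomial ℕ ℝ) :
      (∑ k ∈ p.vars, (X (k + 1) : MvPolynomial ℕ ℝ) • pderiv (R := ℝ) k) q =
        ∑ k ∈ p.vars, X (k + 1) * pderiv k q := by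
    have := congrFun (map_sum (Derivation.coeFnAddMonoidHom (R := ℝ))
      (fun k => (X (k + 1) : MvPolynomial ℕ ℝ) • pderiv (R := ℝ) k) p.vars) q
    exact this.trans (Finset.sum_apply _ _ _)
  rw [h, ← hsum]
  refine derivation_eq_of_forall_mem_vars fun i hi => ?_
  rw [hsum, Dder, mkDerivation_X]
  simp [pderiv_X, Pi.single_apply, hi]

theorem Dop_iterate_eq (k : ℕ) (p : MvPolynomial ℕ ℝ) :
    Dop^[k] p = ((Dder : MvPolynomial ℕ ℝ →ₗ[ℝ] MvPolynomial ℕ ℝ) ^ k) p := by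
  rw [Module.End.pow_apply]
  congr 2
  exact funext Dop_eq_Dder

theorem Dop_iterate_X_zero (k : ℕ) : Dop^[k] (X 0) = X k := by
  induction k with
  | zero => rfl
  | succ k ih => rw [Function.iterate_succ_apply', ih, Dop_eq_Dder, Dder, mkDerivation_X]

theorem hasDerivAt_Ff {g : ℝ → ℝ} (hg : ContDiff ℝ (⊤ : ℕ∞) g) (p : MvPolynomial ℕ ℝ) (y : ℝ) :
    HasDerivAt (Ff g p) (Ff g (Dop p) y) y := by
  rw [Dop_eq_Dder]
  induction p using MvPolynomial.induction_on with
  | C a =>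
    have hfun : Ff g (C a) = fun _ => a := by
      funext z; simp [Ff]
    rw [hfun, derivation_C]
    simpa [Ff] using hasDerivAt_const y a
  | add p q hp hq =>
    have hfun : Ff g (p + q) = Ff g p + Ff g q := by
      funext z; simp [Ff]
    rw [hfun]
    simpa [Ff] using hp.add hq
  | mul_X p i hp =>
    have hX : HasDerivAt (iteratedDeriv i g) (iteratedDeriv (i + 1) g y) y := by
      rw [iteratedDeriv_succ]
      exact ((hg.differentiable_iteratedDeriv i (by exact_mod_cast ENat.natCast_lt_top i)) y).hasDerivAt
    have := hp.mul hX
    have hfun : Ff g (p * X i) = Ff g p * iteratedDeriv i g := by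
      funext z; simp [Ff]
    rw [hfun]
    refine this.congr_deriv ?_
    simp only [Ff, Derivation.leibniz, Dder, mkDerivation_X, smul_eq_mul, map_add, map_mul, eval_X]
    ring

theorem iteratedDeriv_Ff {g : ℝ → ℝ} (hg : ContDiff ℝ (⊤ : ℕ∞) g) (p : MvPolynomial ℕ ℝ) (k : ℕ) :
    iteratedDeriv k (Ff g p) = Ff g (Dop^[k] p) := by
  induction k with
  | zero => simp
  | succ k ih =>
    rw [iteratedDeriv_succ, ih, Function.iterate_succ_apply']
    exact funext fun y => (hasDerivAt_Ff hg _ y).deriv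

/-- The polynomial `p(X + t V)` in the variable `t`. -/
noncomputable def shiftAlong (V : ℕ → MvPolynomial ℕ ℝ) :
    MvPolynomial ℕ ℝ →ₐ[ℝ] Polynomial (MvPolynomial ℕ ℝ) :=
  aeval fun k => Polynomial.C (X k) + Polynomial.C (V k) * Polynomial.X

theorem derivative_shiftAlong (V : ℕ → MvPolynomial ℕ ℝ) {s : Finset ℕ} {p : MvPolynomial ℕ ℝ}
    (hp : p ∈ supported ℝ (s : Set ℕ)) :
    Polynomial.derivative (shiftAlong V p) =
      ∑ k ∈ s, Polynomial.C (V k) * shiftAlong V (pderiv k p) := by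
  induction hp using Algebra.adjoin_induction with
  | mem x hx =>
    obtain ⟨i, hi, rfl⟩ := hx
    have hi' : i ∈ s := hi
    simp [shiftAlong, pderiv_X, Pi.single_apply, apply_ite, hi']
  | algebraMap r =>
    rw [AlgHom.commutes, IsScalarTower.algebraMap_apply ℝ (MvPolynomial ℕ ℝ)]
    simp [algebraMap_eq]
  | add x y _ _ hx hy => simp [hx, hy, mul_add, Finset.sum_add_distrib]
  | mul x y _ _ hx hy =>
    simp only [map_mul, Polynomial.derivative_mul, hx, hy, pderiv_mul, map_add, Finset.sum_mul,
      Finset.mul_sum, ← Finset.sum_add_distrib]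
    exact Finset.sum_congr rfl fun k _ => by ring

theorem pderiv_mem_supported {s : Set ℕ} {p : MvPolynomial ℕ ℝ} (hp : p ∈ supported ℝ s) (i : ℕ) :
    pderiv i p ∈ supported ℝ s := by
  induction hp using Algebra.adjoin_induction with
  | mem x hx =>
    obtain ⟨j, -, rfl⟩ := hx
    rw [pderiv_X, Pi.single_apply]
    split_ifs
    exacts [one_mem _, zero_mem _]
  | algebraMap r => simp [algebraMap_eq]
  | add x y _ _ hx hy => rw [map_add]; exact add_mem hx hy
  | mul x y hx' hy' hx hy =>
    rw [pderiv_mul]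
    exact add_mem (mul_mem hx hy') (mul_mem hx' hy)

theorem pderivs_zero {n : ℕ} (k : Fin n → ℕ) : pderivs k 0 = 0 := by
  induction n with
  | zero => rfl
  | succ n ih => rw [pderivs, map_zero, ih]

theorem pderivs_eq_zero {s : Set ℕ} {n : ℕ} {k : Fin n → ℕ} {j : Fin n} (hj : k j ∉ s)
    {p : MvPolynomial ℕ ℝ} (hp : p ∈ supported ℝ s) : pderivs k p = 0 := by
  induction n generalizing p with
  | zero => exact Fin.elim0 j
  | succ n ih =>
    rw [pderivs]
    induction j using Fin.cases with
    | zero =>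
      rw [pderiv_eq_zero_of_notMem_vars fun h => hj (mem_supported.1 hp h), pderivs_zero]
    | succ j => exact ih (k := k ∘ Fin.succ) hj (pderiv_mem_supported hp _)

theorem factorial_mul_coeff_shiftAlong (V : ℕ → MvPolynomial ℕ ℝ) {s : Finset ℕ} (n : ℕ)
    {p : MvPolynomial ℕ ℝ} (hp : p ∈ supported ℝ (s : Set ℕ)) :
    (n.factorial : MvPolynomial ℕ ℝ) * (shiftAlong V p).coeff n =
      ∑ k ∈ Fintype.piFinset fun _ : Fin n => s, (∏ j, V (k j)) * pderivs k p := by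
  induction n generalizing p with
  | zero =>
    have h : (Polynomial.constantCoeff.comp (shiftAlong V : _ →+* _)) p = p := by
      conv_rhs => rw [← RingHom.id_apply p]
      congr 1
      ext i <;> simp [shiftAlong]
    simpa [pderivs] using h
  | succ n ih =>
    have h := congrArg (fun q => (n.factorial : MvPolynomial ℕ ℝ) * q.coeff n)
      (derivative_shiftAlong V hp)
    simp only [Polynomial.coeff_derivative, Polynomial.finsetSum_coeff, Polynomial.coeff_C_mul,
      Finset.mul_sum] at h
    have h₂ : ((n + 1).factorial : MvPolynomial ℕ ℝ) * (shiftAlong V p).coeff (n + 1) =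
        ∑ i ∈ s, V i * ∑ k ∈ Fintype.piFinset fun _ : Fin n => s,
          (∏ j, V (k j)) * pderivs k (pderiv i p) := by
      rw [Nat.factorial_succ]
      push_cast
      calc _ = _ := by ring
        _ = _ := h
        _ = _ := Finset.sum_congr rfl fun i _ => by
          rw [← ih (pderiv_mem_supported hp i)]; ring
    rw [h₂]
    simp only [Finset.mul_sum]
    rw [← Finset.sum_product']
    refine Finset.sum_bij' (fun x _ => Fin.cons x.1 x.2) (fun k _ => (k 0, Fin.tail k)) ?_ ?_ ?_ ?_ ?_
    · rintro ⟨i, k⟩ h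
      simp only [Finset.mem_product, Fintype.mem_piFinset] at h ⊢
      exact Fin.cases h.1 h.2
    · intro k h
      simp only [Finset.mem_product, Fintype.mem_piFinset] at h ⊢
      exact ⟨h 0, fun j => h j.succ⟩
    · simp
    · simp
    · rintro ⟨i, k⟩ -
      simp only [Fin.prod_univ_succ, Fin.cons_zero, Fin.cons_succ, pderivs, mul_assoc]
      rfl

theorem insert1_eq_sum {s : Finset ℕ} {p : MvPolynomial ℕ ℝ} (hp : p ∈ supported ℝ (s : Set ℕ))
    {n : ℕ} (βs : Fin n → MI) :
    insert1 βs p = ∑ k ∈ Fintype.piFinset fun _ : Fin n => s,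
      (∏ j, Dop^[k j] (zm (βs j))) * pderivs k p := by
  refine finsum_eq_sum_of_support_subset _ fun k hk => ?_
  simp only [Finset.mem_coe, Fintype.mem_piFinset]
  by_contra! h
  obtain ⟨j, hj⟩ := h
  exact hk (by simp only; rw [pderivs_eq_zero (s := s) (by simpa using hj) hp, mul_zero])

/-- `M_b` is the substitution `X_k ↦ X_k + D^k Q` with `Q = ∑_α (b(α)/S(α)) z^α`. -/
theorem Mop_eq_aeval {b : MI → ℝ} (hbf : (Function.support b).Finite)
    (hbp : ∀ β, ¬ Populated β → b β = 0) (p : MvPolynomial ℕ ℝ) :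
    Mop b p = aeval (fun k => X k +
      Dop^[k] (∑ α ∈ hbf.toFinset, (b α / S α) • zm α) : ℕ → MvPolynomial ℕ ℝ) p := by
  set V : ℕ → MvPolynomial ℕ ℝ :=
    fun k => Dop^[k] (∑ α ∈ hbf.toFinset, (b α / S α) • zm α) with hV
  have hp := p.mem_supported_vars
  have hterm (n : ℕ) : (n.factorial : ℝ)⁻¹ • (∑ᶠ αs : Fin n → MI,
      if ∀ j, Populated (αs j) then (∏ j, b (αs j) / S (αs j)) • insert1 αs p else 0) =
      (shiftAlong V p).coeff n := by
    have hsum : (∑ᶠ αs : Fin n → MI,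
        if ∀ j, Populated (αs j) then (∏ j, b (αs j) / S (αs j)) • insert1 αs p else 0) =
        ∑ αs ∈ Fintype.piFinset fun _ : Fin n => hbf.toFinset,
          (∏ j, b (αs j) / S (αs j)) • insert1 αs p := by
      have hite (αs : Fin n → MI) :
          (if ∀ j, Populated (αs j) then (∏ j, b (αs j) / S (αs j)) • insert1 αs p else 0) =
          (∏ j, b (αs j) / S (αs j)) • insert1 αs p := by
        split_ifs with h
        · rfl
        · obtain ⟨j, hj⟩ := not_forall.1 h
          rw [Finset.prod_eq_zero (Finset.mem_univ j) (by rw [hbp _ hj, zero_div]), zero_smul]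
      simp only [hite]
      refine finsum_eq_sum_of_support_subset _ fun αs hαs => ?_
      simp only [Finset.mem_coe, Fintype.mem_piFinset, Set.Finite.mem_toFinset,
        Function.mem_support]
      intro j hj
      exact hαs (by
        simp only
        rw [Finset.prod_eq_zero (Finset.mem_univ j) (by rw [hj, zero_div]), zero_smul])
    have hVk (k : ℕ) : V k = ∑ α ∈ hbf.toFinset, (b α / S α) • Dop^[k] (zm α) := by
      simp only [hV, Dop_iterate_eq, map_sum, map_smul]
    have hcoeff := factorial_mul_coeff_shiftAlong V n hp
    have hfac : (n.factorial : ℝ) ≠ 0 := by positivity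
    rw [inv_smul_eq_iff₀ hfac, hsum, Nat.cast_smul_eq_nsmul, nsmul_eq_mul, hcoeff]
    simp only [hVk, Finset.prod_univ_sum, insert1_eq_sum hp, Finset.smul_sum, Finset.sum_mul]
    rw [Finset.sum_comm]
    refine Finset.sum_congr rfl fun k _ => Finset.sum_congr rfl fun αs _ => ?_
    rw [Finset.prod_smul, smul_mul_assoc]
  have heval : aeval (fun k => X k + V k) p = (shiftAlong V p).eval 1 := by
    have hring : ((aeval fun k => X k + V k : MvPolynomial ℕ ℝ →ₐ[ℝ] MvPolynomial ℕ ℝ) :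
        MvPolynomial ℕ ℝ →+* MvPolynomial ℕ ℝ) =
        (Polynomial.evalRingHom 1).comp (shiftAlong V : MvPolynomial ℕ ℝ →+* _) := by
      ext i <;> simp [shiftAlong, IsScalarTower.algebraMap_apply ℝ (MvPolynomial ℕ ℝ)
        (Polynomial (MvPolynomial ℕ ℝ)), algebraMap_eq]
    exact congrArg (fun φ => φ p) hring
  rw [heval, Polynomial.eval_eq_sum, Polynomial.sum, Mop]
  simp only [hterm, one_pow, mul_one]
  exact finsum_eq_sum_of_support_subset _ fun n hn => by simpa using hn

/-- Key identity for the substitution law: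
`F_g[M_b(z^β)](y) = ∏_k (G^{(k)}(y))^{β(k)}` where `G = g + ∑_α (b(α)/S(α)) F_g[z^α]`. -/
theorem Ff_Mop_eq_prod_deriv_G
    (g : ℝ → ℝ) (hg : ContDiff ℝ (⊤ : ℕ∞) g)
    (b : MI → ℝ) (hbf : (Function.support b).Finite)
    (hbp : ∀ β, ¬ Populated β → b β = 0)
    (G : ℝ → ℝ)
    (hG : ∀ y, G y = g y + ∑ᶠ α : MI, if Populated α then b α / S α * Ff g (zm α) y else 0)
    (β : MI) (hβ : Populated β) (y : ℝ) :
    Ff g (Mop b (zm β)) y = β.prod fun k m => (iteratedDeriv k G y) ^ m := by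
  have hGF : G = Ff g (X 0 + ∑ α ∈ hbf.toFinset, (b α / S α) • zm α) := by
    funext z
    rw [hG z, finsum_eq_sum_of_support_subset (s := hbf.toFinset)]
    · simp only [Ff, map_add, map_sum, smul_eval, eval_X, iteratedDeriv_zero]
      congr 1
      refine Finset.sum_congr rfl fun α hα => if_pos ?_
      by_contra h
      exact (by simpa using hα : b α ≠ 0) (hbp α h)
    · intro α hα
      simp only [Set.Finite.coe_toFinset, Function.mem_support]
      intro h
      exact hα (by simp [h])
  have hGk (k : ℕ) : iteratedDeriv k G y =
      Ff g (X k + Dop^[k] (∑ α ∈ hbf.toFinset, (b α / S α) • zm α)) y := by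
    rw [hGF, iteratedDeriv_Ff hg, Dop_iterate_eq, map_add, ← Dop_iterate_eq, ← Dop_iterate_eq,
      Dop_iterate_X_zero]
  rw [Mop_eq_aeval hbf hbp, zm, aeval_monomial, map_one, one_mul]
  simp only [hGk, Ff, Finsupp.prod, map_prod, map_pow]
end
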